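/- Let Ω ⊆ ℝ^N be Lebesgue measurable with |Ω| < ∞ and D := dim_B(∞,Ω) < −N (existing). Assume Ω is Minkowski measurable at infinity and that ζ_{∞,Ω} has a meromorphic continuation to an open neighborhood of s = D. Let Φ : ℝ^N \ {0} → ℝ^N, Φ(x) = x/|x|², be the geometric inversion. Then the inverted relative fractal drum ({0}, Φ(Ω)) is Minkowski measurable (in the classical relative sense) with relative Minkowski dimension D, and 𝓜^D({0},Φ(Ω)) = −((N+D)/(N−D)) · 𝓜^D(∞,Ω). -/

import Mathlib

open MeasureTheory Filter Set Complex Topology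
open scoped ENNReal Real

noncomputable section

/-- The "tail" of `Ω` beyond radius `t`: the complement of the open Euclidean ball of
radius `t` centered at `0`, intersected with `Ω`. -/
def tailSet (N : ℕ) (Ω : Set (EuclideanSpace ℝ (Fin N))) (t : ℝ) :
    Set (EuclideanSpace ℝ (Fin N)) :=
  {x | x ∈ Ω ∧ t ≤ ‖x‖}

/-- The tube function `t ↦ |_tΩ|` at infinity. -/
def tubeVol (N : ℕ) (Ω : Set (EuclideanSpace ℝ (Fin N))) (t : ℝ) : ℝ :=
  (volume (tailSet N Ω t)).toReal

/-- Upper `r`-dimensional Minkowski content of `Ω` at infinity. -/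
def upperMinkContent (N : ℕ) (Ω : Set (EuclideanSpace ℝ (Fin N))) (r : ℝ) : ℝ≥0∞ :=
  Filter.limsup (fun t : ℝ => volume (tailSet N Ω t) / ENNReal.ofReal (t ^ ((N : ℝ) + r)))
    Filter.atTop

/-- Lower `r`-dimensional Minkowski content of `Ω` at infinity. -/
def lowerMinkContent (N : ℕ) (Ω : Set (EuclideanSpace ℝ (Fin N))) (r : ℝ) : ℝ≥0∞ :=
  Filter.liminf (fun t : ℝ => volume (tailSet N Ω t) / ENNReal.ofReal (t ^ ((N : ℝ) + r)))
    Filter.atTop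

/-- Upper Minkowski dimension of `Ω` at infinity. -/
def upperMinkDim (N : ℕ) (Ω : Set (EuclideanSpace ℝ (Fin N))) : ℝ :=
  sInf {r : ℝ | upperMinkContent N Ω r = 0}

/-- Lower Minkowski dimension of `Ω` at infinity. -/
def lowerMinkDim (N : ℕ) (Ω : Set (EuclideanSpace ℝ (Fin N))) : ℝ :=
  sInf {r : ℝ | lowerMinkContent N Ω r = 0}

/-- Distance (Lapidus) zeta function of `Ω` at infinity. -/
def distZeta (N : ℕ) (Ω : Set (EuclideanSpace ℝ (Fin N))) (T : ℝ) (s : ℂ) : ℂ :=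
  ∫ x in tailSet N Ω T, (‖x‖ : ℂ) ^ (-s - (N : ℂ))

/-- Tube zeta function of `Ω` at infinity. -/
def tubeZeta (N : ℕ) (Ω : Set (EuclideanSpace ℝ (Fin N))) (T : ℝ) (s : ℂ) : ℂ :=
  ∫ t in Set.Ioi T, (t : ℂ) ^ (-s - (N : ℂ) - 1) * ((tubeVol N Ω t : ℝ) : ℂ)

/-- Abscissa of (absolute) convergence of the distance zeta function at infinity. -/
def distAbscissa (N : ℕ) (Ω : Set (EuclideanSpace ℝ (Fin N))) (T : ℝ) : ℝ :=
  sInf {σ : ℝ | ∀ s : ℂ, σ < s.re →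
    IntegrableOn (fun x => (‖x‖ : ℂ) ^ (-s - (N : ℂ))) (tailSet N Ω T) volume}

/-- Abscissa of (absolute) convergence of the tube zeta function at infinity. -/
def tubeAbscissa (N : ℕ) (Ω : Set (EuclideanSpace ℝ (Fin N))) (T : ℝ) : ℝ :=
  sInf {σ : ℝ | ∀ s : ℂ, σ < s.re →
    IntegrableOn (fun t : ℝ => (t : ℂ) ^ (-s - (N : ℂ) - 1) * ((tubeVol N Ω t : ℝ) : ℂ))
      (Set.Ioi T) volume}

/-- The geometric inversion `Φ(x) = x/|x|²`. -/
def geomInv (N : ℕ) (x : EuclideanSpace ℝ (Fin N)) : EuclideanSpace ℝ (Fin N) :=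
  (‖x‖ ^ 2)⁻¹ • x

/-- Layer cake formula for a negative power of a function bounded below by `u > 0`. -/
theorem integral_rpow_neg_eq_sub_integral_Ioi {α : Type*} [MeasurableSpace α] (μ : Measure α)
    [IsFiniteMeasure μ] {ρ : α → ℝ} (hρ : Measurable ρ) {u b : ℝ} (hu : 0 < u) (hb : 0 ≤ b)
    (hle : ∀ᵐ x ∂μ, u ≤ ρ x) :
    ∫ x, ρ x ^ (-b) ∂μ =
      u ^ (-b) * μ.real univ - ∫ r in Ioi u, b * r ^ (-b - 1) * μ.real {x | r ≤ ρ x} := by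
  have hint : Integrable (fun x => ρ x ^ (-b)) μ := by
    refine Integrable.of_bound (hρ.pow_const _).aestronglyMeasurable (u ^ (-b)) ?_
    filter_upwards [hle] with x hx
    rw [Real.norm_of_nonneg (Real.rpow_nonneg (hu.le.trans hx) _)]
    exact Real.rpow_le_rpow_of_nonpos hu hx (by linarith)
  have hcont : ContinuousOn (fun t : ℝ => b * (t + u) ^ (-b - 1)) (Ici 0) := by
    refine continuousOn_const.mul (ContinuousOn.rpow_const (by fun_prop) fun t ht => Or.inl ?_)
    have : (0 : ℝ) ≤ t := ht
    positivity
  have hprim : ∀ y, 0 ≤ y → ∫ t in (0 : ℝ)..y, b * (t + u) ^ (-b - 1) =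
      u ^ (-b) - (y + u) ^ (-b) := by
    intro y hy
    have hsub : uIcc 0 y ⊆ Ici 0 := by
      rw [uIcc_of_le hy]
      exact fun t ht => ht.1
    rw [intervalIntegral.integral_eq_sub_of_hasDerivAt (f := fun t => -(t + u) ^ (-b))
      (fun t ht => ?_) (hcont.mono hsub).intervalIntegrable]
    · simp only [zero_add]
      ring
    · have ht0 : 0 < t + u := add_pos_of_nonneg_of_pos (hsub ht) hu
      have h := (((hasDerivAt_id t).add_const u).rpow_const (p := -b) (Or.inl ht0.ne')).neg
      refine h.congr_deriv ?_
      simp only [id]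
      ring
  have hcake := lintegral_comp_eq_lintegral_meas_le_mul μ (f := fun x => ρ x - u)
    (g := fun t => b * (t + u) ^ (-b - 1)) (by filter_upwards [hle] with x hx; simpa using hx)
    (hρ.sub_const u).aemeasurable
    (fun t ht => (hcont.mono (by
      rw [uIcc_of_le (le_of_lt ht)]
      exact fun s hs => hs.1)).intervalIntegrable)
    (by
      filter_upwards [ae_restrict_mem measurableSet_Ioi] with t ht
      have : (0 : ℝ) < t := ht
      positivity)
  have hleft : ∫ x, (u ^ (-b) - ρ x ^ (-b)) ∂μ =
      (∫⁻ x, ENNReal.ofReal (∫ t in (0 : ℝ)..(ρ x - u), b * (t + u) ^ (-b - 1)) ∂μ).toReal := by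
    rw [integral_eq_lintegral_of_nonneg_ae]
    · congr 1
      refine lintegral_congr_ae ?_
      filter_upwards [hle] with x hx
      rw [hprim _ (sub_nonneg.2 hx), sub_add_cancel]
    · filter_upwards [hle] with x hx
      exact sub_nonneg.2 (Real.rpow_le_rpow_of_nonpos hu hx (by linarith))
    · exact ((hρ.pow_const _).const_sub _).aestronglyMeasurable
  have hanti : Antitone fun r : ℝ => μ.real {x | r ≤ ρ x} :=
    fun r s hrs => measureReal_mono fun x hx => hrs.trans hx
  have hright : ∫ r in Ioi u, b * r ^ (-b - 1) * μ.real {x | r ≤ ρ x} =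
      (∫⁻ t in Ioi (0 : ℝ),
        μ {x | t ≤ ρ x - u} * ENNReal.ofReal (b * (t + u) ^ (-b - 1))).toReal := by
    have hshift := (measurePreserving_add_right volume u).setIntegral_preimage_emb
      (measurableEmbedding_addRight u)
      (fun r : ℝ => b * r ^ (-b - 1) * μ.real {x | r ≤ ρ x}) (Ioi u)
    rw [preimage_add_const_Ioi, sub_self] at hshift
    rw [← hshift, integral_eq_lintegral_of_nonneg_ae]
    · congr 1
      refine setLIntegral_congr_fun measurableSet_Ioi fun t ht => ?_
      have ht0 : (0 : ℝ) < t := ht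
      simp only [le_sub_iff_add_le]
      rw [ENNReal.ofReal_mul (by positivity), ofReal_measureReal, mul_comm]
    · filter_upwards [ae_restrict_mem measurableSet_Ioi] with t ht
      have ht0 : (0 : ℝ) < t := ht
      simp only [Pi.zero_apply]
      positivity
    · have h1 : Measurable fun t : ℝ => μ.real {x | t + u ≤ ρ x} :=
        hanti.measurable.comp (measurable_id.add_const u)
      exact (Measurable.mul (by fun_prop) h1).aestronglyMeasurable
  rw [hright, ← hcake, ← hleft, integral_sub (integrable_const _) hint, integral_const, smul_eq_mul]
  ring

/-- A regularly decaying function `V r ∼ M r ^ (-a)` has the expected weighted tail integrals. -/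
theorem tendsto_rpow_mul_integral_Ioi {V : ℝ → ℝ} (hV : Measurable V) {a b M : ℝ} (ha : 0 < a)
    (hb : 0 ≤ b) (hlim : Tendsto (fun t => t ^ a * V t) atTop (𝓝 M)) :
    Tendsto (fun u => u ^ (a + b) * ∫ r in Ioi u, b * r ^ (-b - 1) * V r) atTop
      (𝓝 (b * M / (a + b))) := by
  have hscale : ∀ u : ℝ, 0 < u → u ^ (a + b) * ∫ r in Ioi u, b * r ^ (-b - 1) * V r =
      ∫ y in Ioi (1 : ℝ), b * y ^ (-(a + b) - 1) * ((u * y) ^ a * V (u * y)) := by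
    intro u hu
    have h := integral_comp_mul_left_Ioi (fun r => b * r ^ (-b - 1) * V r) 1 hu
    rw [mul_one, smul_eq_mul, eq_comm, inv_mul_eq_iff_eq_mul₀ hu.ne'] at h
    rw [h, ← mul_assoc, ← integral_const_mul]
    refine setIntegral_congr_fun measurableSet_Ioi fun y hy => ?_
    have hy0 : (0 : ℝ) < y := one_pos.trans hy
    rw [Real.mul_rpow hu.le hy0.le, Real.mul_rpow hu.le hy0.le,
      show -(a + b) - 1 = -b - 1 - a by ring, Real.rpow_sub hy0 (-b - 1) a, Real.rpow_add hu,
      show -b - 1 = -(b + 1) by ring, Real.rpow_neg hu.le, Real.rpow_add hu b 1, Real.rpow_one]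
    have := (Real.rpow_pos_of_pos hy0 a).ne'
    have := (Real.rpow_pos_of_pos hu b).ne'
    field_simp
  have hval : ∫ y in Ioi (1 : ℝ), b * y ^ (-(a + b) - 1) * M = b * M / (a + b) := by
    rw [integral_mul_const, integral_const_mul,
      integral_Ioi_rpow_of_lt (by linarith) one_pos, Real.one_rpow]
    have : a + b ≠ 0 := by positivity
    rw [sub_add_cancel]
    field_simp
  rw [← hval]
  refine Tendsto.congr' (f₁ := fun u =>
    ∫ y in Ioi (1 : ℝ), b * y ^ (-(a + b) - 1) * ((u * y) ^ a * V (u * y))) ?_ ?_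
  · filter_upwards [eventually_gt_atTop 0] with u hu using (hscale u hu).symm
  · obtain ⟨R, hR⟩ := eventually_atTop.1 (hlim.abs.eventually (gt_mem_nhds (lt_add_one |M|)))
    refine tendsto_integral_filter_of_dominated_convergence
      (fun y => b * y ^ (-(a + b) - 1) * (|M| + 1)) ?_ ?_ ?_ ?_
    · exact Eventually.of_forall fun u => by
        have : Measurable fun y => V (u * y) := hV.comp (measurable_const_mul u)
        exact (by fun_prop : Measurable _).aestronglyMeasurable
    · filter_upwards [eventually_ge_atTop R, eventually_gt_atTop 0] with u hu hu0
      filter_upwards [ae_restrict_mem measurableSet_Ioi] with y hy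
      have hy1 : (1 : ℝ) < y := hy
      have hy0 : (0 : ℝ) < y := one_pos.trans hy1
      rw [norm_mul, Real.norm_of_nonneg (by positivity), Real.norm_eq_abs]
      exact mul_le_mul_of_nonneg_left (hR _ (by nlinarith)).le (by positivity)
    · exact ((integrableOn_Ioi_rpow_of_lt (by linarith) one_pos).const_mul b).mul_const _
    · filter_upwards [ae_restrict_mem measurableSet_Ioi] with y hy
      have hy0 : (0 : ℝ) < y := one_pos.trans hy
      exact (hlim.comp (tendsto_id.atTop_mul_const hy0)).const_mul _

theorem geomInv_eq_inversion (N : ℕ) : geomInv N = EuclideanGeometry.inversion 0 1 := by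
  funext x
  simp [geomInv, EuclideanGeometry.inversion]

theorem norm_geomInv (N : ℕ) (x : EuclideanSpace ℝ (Fin N)) : ‖geomInv N x‖ = ‖x‖⁻¹ := by
  have h := EuclideanGeometry.dist_inversion_center (0 : EuclideanSpace ℝ (Fin N)) x 1
  simpa [geomInv_eq_inversion] using h

/-- Change of variables for the geometric inversion. -/
theorem volume_image_geomInv (N : ℕ) {S : Set (EuclideanSpace ℝ (Fin N))} (hS : MeasurableSet S)
    (h0 : ∀ x ∈ S, x ≠ 0) :
    volume (geomInv N '' S) = ∫⁻ x in S, ENNReal.ofReal (‖x‖ ^ (-(2 * N : ℝ))) := by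
  rw [geomInv_eq_inversion, ← lintegral_abs_det_fderiv_eq_addHaar_image volume hS
    (fun x hx => (EuclideanGeometry.hasFDerivAt_inversion (h0 x hx)).hasFDerivWithinAt)
    (EuclideanGeometry.inversion_injective _ one_ne_zero).injOn]
  refine setLIntegral_congr_fun hS fun x hx => ?_
  have hx0 : 0 < ‖x‖ := norm_pos_iff.2 (h0 x hx)
  have hdet : |((ℝ ∙ (x - 0))ᗮ.reflection :
      EuclideanSpace ℝ (Fin N) →L[ℝ] EuclideanSpace ℝ (Fin N)).det| = 1 := by
    have h := Submodule.det_reflection (ℝ ∙ (x - 0))ᗮ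
    rw [ContinuousLinearMap.det]
    erw [h]
    simp
  rw [ContinuousLinearMap.det, ContinuousLinearMap.toLinearMap_smul, LinearMap.det_smul, abs_mul]
  rw [ContinuousLinearMap.det] at hdet
  rw [hdet, finrank_euclideanSpace_fin, mul_one, dist_zero_right, ← pow_mul,
    abs_of_nonneg (by positivity), Real.rpow_neg hx0.le, one_div, inv_pow]
  congr 2
  exact_mod_cast (Real.rpow_natCast ‖x‖ (2 * N)).symm

theorem measurableSet_tailSet {N : ℕ} {Ω : Set (EuclideanSpace ℝ (Fin N))}
    (hΩ : MeasurableSet Ω) (t : ℝ) : MeasurableSet (tailSet N Ω t) :=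
  hΩ.inter (measurableSet_le measurable_const measurable_norm)

/-- The volume of the inverted set inside a ball, in terms of the tube function at infinity. -/
theorem volume_geomInv_image_inter_ball (N : ℕ) {Ω : Set (EuclideanSpace ℝ (Fin N))}
    (hmeas : MeasurableSet Ω) (hfin : volume Ω < ⊤) (h0 : ∀ x ∈ Ω, x ≠ 0) {u : ℝ} (hu : 0 < u) :
    (volume {x | x ∈ geomInv N '' Ω ∧ ‖x‖ < u⁻¹}).toReal =
      u ^ (-(2 * N : ℝ)) * tubeVol N Ω u -
        ∫ r in Ioi u, (2 * N : ℝ) * r ^ (-(2 * N : ℝ) - 1) * tubeVol N Ω r := by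
  have himage : {x | x ∈ geomInv N '' Ω ∧ ‖x‖ < u⁻¹} =
      geomInv N '' (Ω ∩ {x | u < ‖x‖}) := by
    ext y
    constructor
    · rintro ⟨⟨x, hx, rfl⟩, hxt⟩
      rw [norm_geomInv, inv_lt_inv₀ (norm_pos_iff.2 (h0 x hx)) hu] at hxt
      exact ⟨x, ⟨hx, hxt⟩, rfl⟩
    · rintro ⟨x, ⟨hx, hxt⟩, rfl⟩
      refine ⟨⟨x, hx, rfl⟩, ?_⟩
      rwa [norm_geomInv, inv_lt_inv₀ (norm_pos_iff.2 (h0 x hx)) hu]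
  have hae : (Ω ∩ {x | u < ‖x‖} : Set (EuclideanSpace ℝ (Fin N))) =ᵐ[volume]
      tailSet N Ω u := by
    have hsphere : ∀ᵐ x : EuclideanSpace ℝ (Fin N), x ∉ Metric.sphere 0 u :=
      measure_eq_zero_iff_ae_notMem.1 (Measure.addHaar_sphere_of_ne_zero volume 0 hu.ne')
    filter_upwards [hsphere] with x hx
    rw [mem_sphere_zero_iff_norm] at hx
    exact propext (and_congr_right fun _ => ⟨fun h => le_of_lt h, fun h => lt_of_le_of_ne h (Ne.symm hx)⟩)
  have hS := measurableSet_tailSet hmeas u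
  have : IsFiniteMeasure (volume.restrict (tailSet N Ω u)) :=
    ⟨by
      rw [Measure.restrict_apply_univ]
      exact (measure_mono fun x hx => hx.1).trans_lt hfin⟩
  rw [himage, volume_image_geomInv N
    (hmeas.inter (measurableSet_lt measurable_const measurable_norm))
    (fun x hx => h0 x hx.1), setLIntegral_congr hae,
    ← integral_eq_lintegral_of_nonneg_ae
      (Eventually.of_forall fun x => Real.rpow_nonneg (norm_nonneg x) _)
      (measurable_norm.pow_const _).aestronglyMeasurable,
    integral_rpow_neg_eq_sub_integral_Ioi _ measurable_norm hu (by positivity)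
      ((ae_restrict_mem hS).mono fun x hx => hx.2)]
  congr 1
  · rw [measureReal_restrict_apply_univ]
    rfl
  · refine setIntegral_congr_fun measurableSet_Ioi fun r hr => ?_
    have hset : {x : EuclideanSpace ℝ (Fin N) | r ≤ ‖x‖} ∩ tailSet N Ω u = tailSet N Ω r := by
      ext x
      exact ⟨fun h => ⟨h.2.1, h.1⟩, fun h => ⟨h.2, h.1, (le_of_lt hr).trans h.2⟩⟩
    rw [measureReal_restrict_apply (measurableSet_le measurable_const measurable_norm), hset]
    rfl

/-- if `Ω` is Minkowski measurable at infinity with `dim_B(∞,Ω) = D < −N` and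
its distance zeta function extends meromorphically to a neighborhood of `D`, then the
inverted relative fractal drum `({0}, Φ(Ω))` is Minkowski measurable with relative
dimension `D` and content `−((N+D)/(N−D))·𝓜^D(∞,Ω)`. -/
theorem geometric_inversion_minkowski_measurability
    (N : ℕ) (Ω : Set (EuclideanSpace ℝ (Fin N)))
    (hmeas : MeasurableSet Ω) (hfin : volume Ω < ⊤)
    (h0 : ∀ x ∈ Ω, x ≠ 0)
    (D : ℝ) (hD : D < -(N : ℝ))
    (hdimlow : lowerMinkDim N Ω = D) (hdimup : upperMinkDim N Ω = D)
    (M : ℝ) (hM : 0 < M)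
    (hmink : Tendsto (fun t : ℝ => tubeVol N Ω t / t ^ ((N : ℝ) + D)) atTop (𝓝 M))
    (T : ℝ) (hT : 0 < T)
    (hmero : ∃ U : Set ℂ, IsOpen U ∧ (D : ℂ) ∈ U ∧
      ∃ g : ℂ → ℂ, DifferentiableOn ℂ g (U \ {(D : ℂ)}) ∧
        ∀ s ∈ U, D < s.re → g s = distZeta N Ω T s) :
    0 < -(((N : ℝ) + D) / ((N : ℝ) - D)) * M ∧
    Tendsto
      (fun t : ℝ =>
        (volume {x | x ∈ geomInv N '' Ω ∧ ‖x‖ < t}).toReal / t ^ ((N : ℝ) - D))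
      (𝓝[>] (0 : ℝ)) (𝓝 (-(((N : ℝ) + D) / ((N : ℝ) - D)) * M)) := by
  have ha : 0 < -((N : ℝ) + D) := by linarith
  have hN : (0 : ℝ) ≤ N := Nat.cast_nonneg N
  have hden : 0 < (N : ℝ) - D := by linarith
  refine ⟨mul_pos (by rw [← neg_div]; exact div_pos ha hden) hM, ?_⟩
  have hlim : Tendsto (fun t => t ^ (-((N : ℝ) + D)) * tubeVol N Ω t) atTop (𝓝 M) := by
    refine hmink.congr' ?_
    filter_upwards [eventually_gt_atTop 0] with t ht
    rw [Real.rpow_neg ht.le, div_eq_inv_mul]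
  have hanti : Antitone (tubeVol N Ω) := fun r s hrs =>
    ENNReal.toReal_mono ((measure_mono fun x hx => hx.1).trans_lt hfin).ne
      (measure_mono fun x hx => ⟨hx.1, hrs.trans hx.2⟩)
  have htail := tendsto_rpow_mul_integral_Ioi hanti.measurable ha
    (by positivity : (0 : ℝ) ≤ 2 * N) hlim
  have hval : M - 2 * N * M / (-((N : ℝ) + D) + 2 * N) =
      -(((N : ℝ) + D) / ((N : ℝ) - D)) * M := by
    rw [show -((N : ℝ) + D) + 2 * N = N - D by ring]
    field_simp
    ring
  rw [← hval]
  refine ((hlim.sub htail).comp tendsto_inv_nhdsGT_zero).congr' ?_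
  filter_upwards [self_mem_nhdsWithin] with t ht
  have ht0 : (0 : ℝ) < t := ht
  have hu : 0 < t⁻¹ := inv_pos.2 ht0
  have hvol := volume_geomInv_image_inter_ball N hmeas hfin h0 hu
  rw [inv_inv] at hvol
  rw [hvol, div_eq_mul_inv, ← Real.inv_rpow ht0.le, Function.comp_apply,
    show -((N : ℝ) + D) + 2 * N = N - D by ring,
    show -((N : ℝ) + D) = -(2 * N) + (N - D) by ring, Real.rpow_add hu]
  ring
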